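/- arXiv:1110.1133 — 2 statements merged into one kernel-verified Lean document; each statement's English description precedes it below -/
import Mathlib

section
/- If an N×N complex matrix A satisfies A†A ≤ I (in the positive semidefinite order) and ‖A‖² ≥ N(1−ε) (Frobenius norm), then there exists an N×N unitary U with (1/√(2N))‖A − U‖ ≤ √(ε/2); in particular D(A, U_N) ≤ √(ε/2) where U_N is the unitary group. -/
open Matrix
open scoped ComplexOrder

/-- Frobenius (Hilbert–Schmidt) norm `‖A‖ = √tr(A†A)`. -/
noncomputable def fnorm {ι : Type*} [Fintype ι] (A : Matrix ι ι ℂ) : ℝ :=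
  Real.sqrt (Matrix.trace (Aᴴ * A)).re

/-- Phase-optimized normalized Frobenius distance
`D(A,B) = min_{θ∈[0,2π)} (1/√(2N)) ‖e^{iθ}A − B‖`. -/
noncomputable def uDist {ι : Type*} [Fintype ι] (A B : Matrix ι ι ℂ) : ℝ :=
  sInf ((fun θ : ℝ => (Real.sqrt (2 * Fintype.card ι))⁻¹ *
    fnorm (Complex.exp (θ * Complex.I) • A - B)) '' Set.Ico 0 (2 * Real.pi))

lemma exists_unitary_aux {N : ℕ} (B : Matrix (Fin N) (Fin N) ℂ) (d : Fin N → ℝ)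
    (hB : Bᴴ * B = Matrix.diagonal (fun i => (d i : ℂ))) (h0 : ∀ i, 0 ≤ d i) (h1 : ∀ i, d i ≤ 1) :
    ∃ W ∈ Matrix.unitaryGroup (Fin N) ℂ, ∑ i, d i ≤ (Matrix.trace (Wᴴ * B)).re := by
  have hent : ∀ i j, ∑ k, star (B k i) * B k j = if i = j then (d i : ℂ) else 0 := by
    intro i j
    have := congrFun (congrFun hB i) j
    simpa [Matrix.mul_apply, Matrix.diagonal_apply] using this
  let v : Fin N → EuclideanSpace ℂ (Fin N) :=
    fun j => WithLp.toLp 2 (fun i => ((Real.sqrt (d j))⁻¹ : ℂ) * B i j)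
  have hv : Orthonormal ℂ (({j | d j ≠ 0} : Set (Fin N)).domRestrict v) := by
    rw [orthonormal_iff_ite]
    rintro ⟨i, hi⟩ ⟨j, hj⟩
    have key : inner ℂ (v i) (v j) =
        ((Real.sqrt (d i))⁻¹ : ℂ) * ((Real.sqrt (d j))⁻¹ : ℂ) * ∑ k, star (B k i) * B k j := by
      simp only [v, PiLp.inner_apply, Finset.mul_sum, RCLike.inner_apply]
      refine Finset.sum_congr rfl fun k _ => ?_
      simp
      ring
    simp only [Subtype.mk.injEq]
    change inner ℂ (v i) (v j) = _
    rw [key, hent]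
    split_ifs with h
    · subst h
      have hs : Real.sqrt (d i) * Real.sqrt (d i) = d i := Real.mul_self_sqrt (h0 i)
      have hd : (d i : ℂ) ≠ 0 := by exact_mod_cast hi
      rw [← mul_inv, ← Complex.ofReal_mul, hs, inv_mul_cancel₀ hd]
    · simp
  obtain ⟨b, hb⟩ := hv.exists_orthonormalBasis_extension_of_card_eq (by simp)
  refine ⟨Matrix.of fun i j => b j i, ?_, ?_⟩
  · rw [Matrix.mem_unitaryGroup_iff']
    ext i j
    have := orthonormal_iff_ite.mp b.orthonormal i j
    rw [PiLp.inner_apply] at this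
    simp only [RCLike.inner_apply] at this
    rw [Matrix.star_eq_conjTranspose, Matrix.mul_apply, Matrix.one_apply, ← this]
    refine Finset.sum_congr rfl fun k _ => ?_
    simp [mul_comm]
  · rw [Matrix.trace, Complex.re_sum]
    refine Finset.sum_le_sum fun j _ => ?_
    simp only [Matrix.diag_apply, Matrix.mul_apply, Matrix.conjTranspose_apply, Matrix.of_apply]
    have hjj := hent j j
    rw [if_pos rfl] at hjj
    by_cases hj : d j = 0
    · have hz : ∀ k, B k j = 0 := by
        have h2 : ∑ k, Complex.normSq (B k j) = 0 := by
          have := congrArg Complex.re hjj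
          simpa [hj, Complex.normSq_apply] using this
        intro k
        have := (Finset.sum_eq_zero_iff_of_nonneg (fun k _ => Complex.normSq_nonneg _)).mp h2 k
          (Finset.mem_univ k)
        exact Complex.normSq_eq_zero.mp this
      simp [hz, hj]
    · rw [hb j hj]
      have : ∑ k, star (v j k) * B k j = ((Real.sqrt (d j))⁻¹ : ℂ) * ∑ k, star (B k j) * B k j := by
        rw [Finset.mul_sum]
        refine Finset.sum_congr rfl fun k _ => ?_
        simp [v]
        ring
      rw [this, hjj]
      have hs : Real.sqrt (d j) * Real.sqrt (d j) = d j := Real.mul_self_sqrt (h0 j)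
      have hpos : 0 < Real.sqrt (d j) := Real.sqrt_pos.mpr (lt_of_le_of_ne (h0 j) (Ne.symm hj))
      have hle : Real.sqrt (d j) ≤ 1 := by
        rw [Real.sqrt_le_iff]; exact ⟨by norm_num, by simpa using h1 j⟩
      rw [← Complex.ofReal_inv, ← Complex.ofReal_mul, Complex.ofReal_re]
      have : (Real.sqrt (d j))⁻¹ * d j = Real.sqrt (d j) := by
        nth_rw 2 [← hs]
        field_simp
      rw [this]
      nlinarith

lemma exists_unitary_trace {N : ℕ} (A : Matrix (Fin N) (Fin N) ℂ)
    (hcontr : Matrix.PosSemidef (1 - Aᴴ * A)) :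
    ∃ U ∈ Matrix.unitaryGroup (Fin N) ℂ,
      (Matrix.trace (Aᴴ * A)).re ≤ (Matrix.trace (Uᴴ * A)).re := by
  have hP : (Aᴴ * A).PosSemidef := Matrix.posSemidef_conjTranspose_mul_self A
  have hH := hP.isHermitian
  obtain ⟨V, hV⟩ : ∃ V : Matrix (Fin N) (Fin N) ℂ, V = hH.eigenvectorUnitary := ⟨_, rfl⟩
  have hVm : V ∈ Matrix.unitaryGroup (Fin N) ℂ := hV ▸ hH.eigenvectorUnitary.2
  have hV1 : Vᴴ * V = 1 := Matrix.mem_unitaryGroup_iff'.mp hVm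
  have hV2 : V * Vᴴ = 1 := Matrix.mem_unitaryGroup_iff.mp hVm
  have hsp : Aᴴ * A = V * Matrix.diagonal (fun i => (hH.eigenvalues i : ℂ)) * Vᴴ := by
    have := hH.spectral_theorem
    rw [Unitary.conjStarAlgAut_apply] at this
    rw [hV]
    exact this
  have hd0 := hP.eigenvalues_nonneg
  change ∀ i, 0 ≤ hH.eigenvalues i at hd0
  clear hV
  generalize hH.eigenvalues = d at hsp hd0
  have hB : (A * V)ᴴ * (A * V) = Matrix.diagonal (fun i => (d i : ℂ)) := by
    calc (A * V)ᴴ * (A * V) = Vᴴ * (Aᴴ * A) * V := by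
          simp only [Matrix.conjTranspose_mul, Matrix.mul_assoc]
      _ = (Vᴴ * V) * Matrix.diagonal (fun i => (d i : ℂ)) * (Vᴴ * V) := by
          rw [hsp]; simp only [Matrix.mul_assoc]
      _ = _ := by rw [hV1]; simp
  have h1 : ∀ i, d i ≤ 1 := by
    intro i
    have h := hcontr.conjTranspose_mul_mul_same V
    have e : Vᴴ * (1 - Aᴴ * A) * V = 1 - Matrix.diagonal (fun i => (d i : ℂ)) := by
      rw [← hB, Matrix.mul_sub, Matrix.sub_mul, Matrix.mul_one, hV1]
      simp only [Matrix.conjTranspose_mul, Matrix.mul_assoc]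
    rw [e] at h
    have := h.diag_nonneg (i := i)
    simp at this
    exact_mod_cast this
  obtain ⟨W, hW, hle⟩ := exists_unitary_aux (A * V) _ hB hd0 h1
  refine ⟨W * Vᴴ, mul_mem hW (Unitary.star_mem hVm), ?_⟩
  have e1 : Matrix.trace ((W * Vᴴ)ᴴ * A) = Matrix.trace (Wᴴ * (A * V)) := by
    rw [Matrix.conjTranspose_mul, Matrix.conjTranspose_conjTranspose, Matrix.mul_assoc,
      Matrix.trace_mul_comm, Matrix.mul_assoc]
  have e2 : Matrix.trace (Aᴴ * A) = ((∑ i, d i : ℝ) : ℂ) := by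
    rw [hsp, Matrix.mul_assoc, Matrix.trace_mul_comm, Matrix.mul_assoc, hV1, Matrix.mul_one,
      Matrix.trace_diagonal]
    push_cast
    rfl
  rw [e1, e2, Complex.ofReal_re]
  exact hle

/-- If A†A ≤ I and ‖A‖² ≥ N(1−ε), then some unitary U satisfies
(1/√(2N))‖A − U‖ ≤ √(ε/2); in particular D(A, 𝕌_N) ≤ √(ε/2). -/
theorem close_to_unitary_of_contraction {N : ℕ} {ε : ℝ}
    (hε0 : 0 ≤ ε) (hε1 : ε ≤ 1)
    (A : Matrix (Fin N) (Fin N) ℂ)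
    (hcontr : Matrix.PosSemidef (1 - Aᴴ * A))
    (hnorm : (N : ℝ) * (1 - ε) ≤ fnorm A ^ 2) :
    ∃ U ∈ Matrix.unitaryGroup (Fin N) ℂ,
      (Real.sqrt (2 * N))⁻¹ * fnorm (A - U) ≤ Real.sqrt (ε / 2) ∧
      uDist A U ≤ Real.sqrt (ε / 2) := by
  obtain ⟨U, hU, hle⟩ := exists_unitary_trace A hcontr
  have hnn : 0 ≤ (Matrix.trace (Aᴴ * A)).re :=
    (Complex.nonneg_iff.mp (Matrix.posSemidef_conjTranspose_mul_self A).trace_nonneg).1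
  rw [fnorm, Real.sq_sqrt hnn] at hnorm
  have hU1 : Uᴴ * U = 1 := Matrix.mem_unitaryGroup_iff'.mp hU
  have hc : (Matrix.trace (Aᴴ * U)).re = (Matrix.trace (Uᴴ * A)).re := by
    have : Aᴴ * U = (Uᴴ * A)ᴴ := by simp
    rw [this, Matrix.trace_conjTranspose]
    simp
  have hb : (Matrix.trace ((A - U)ᴴ * (A - U))).re ≤ N * ε := by
    have : (A - U)ᴴ * (A - U) = Aᴴ * A - Aᴴ * U - Uᴴ * A + 1 := by
      rw [← hU1, Matrix.conjTranspose_sub]; noncomm_ring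
    rw [this]
    simp only [Matrix.trace_add, Matrix.trace_sub, Complex.add_re, Complex.sub_re, hc,
      Matrix.trace_one, Fintype.card_fin, Complex.natCast_re]
    linarith
  have main : (Real.sqrt (2 * N))⁻¹ * fnorm (A - U) ≤ Real.sqrt (ε / 2) := by
    rw [fnorm, ← Real.sqrt_inv, ← Real.sqrt_mul (by positivity)]
    apply Real.sqrt_le_sqrt
    rcases Nat.eq_zero_or_pos N with h | h
    · have : ((2 * (N : ℝ))⁻¹) = 0 := by simp [h]
      rw [this, zero_mul]; positivity
    · have hN : (0 : ℝ) < N := by exact_mod_cast h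
      calc _ ≤ (2 * (N : ℝ))⁻¹ * (N * ε) := by gcongr
        _ = ε / 2 := by field_simp
  refine ⟨U, hU, main, le_trans (csInf_le ?_ ?_) main⟩
  · refine ⟨0, ?_⟩
    rintro _ ⟨θ, _, rfl⟩
    exact mul_nonneg (by positivity) (Real.sqrt_nonneg _)
  · exact ⟨0, ⟨le_refl _, by positivity⟩, by simp⟩
end

section
/- Let U be a 2ⁿ-dimensional unitary such that D(Uσ_xU†, P_n) ≤ δ for every x ∈ Z₄ⁿ. Then there exists a Clifford unitary C (i.e., C P_n C† = P_n) with D(U, C) ≤ 4δ. -/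
open Matrix

/-- The 2×2 Pauli matrices `I, X, Y, Z`. -/
def sigma : Fin 4 → Matrix (Fin 2) (Fin 2) ℂ
  | 0 => 1
  | 1 => !![0, 1; 1, 0]
  | 2 => !![0, -Complex.I; Complex.I, 0]
  | 3 => !![1, 0; 0, -1]

/-- The `n`-qubit Pauli matrix `σ_x = σ_{x₁} ⊗ ⋯ ⊗ σ_{x_n}`. -/
def pauli {n : ℕ} (x : Fin n → Fin 4) :
    Matrix (Fin n → Fin 2) (Fin n → Fin 2) ℂ :=
  fun i j => ∏ k, sigma (x k) (i k) (j k)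

/-- Pauli coefficient `μ_x(A) = tr(σ_x A)/2ⁿ`. -/
noncomputable def pcoef {n : ℕ} (x : Fin n → Fin 4)
    (A : Matrix (Fin n → Fin 2) (Fin n → Fin 2) ℂ) : ℂ :=
  Matrix.trace (pauli x * A) / 2 ^ n

/-- Support of a Pauli index string. -/
def psupp {n : ℕ} (x : Fin n → Fin 4) : Finset (Fin n) :=
  Finset.univ.filter (fun i => x i ≠ 0)

/-- Distance from a matrix to a set of matrices. -/
noncomputable def uDistSet {ι : Type*} [Fintype ι]
    (A : Matrix ι ι ℂ) (S : Set (Matrix ι ι ℂ)) : ℝ :=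
  sInf (uDist A '' S)

/-- The n-qubit Pauli group P_n = {i^k σ_x : k ∈ Z₄, x ∈ Z₄ⁿ}. -/
def PauliGroup (n : ℕ) : Set (Matrix (Fin n → Fin 2) (Fin n → Fin 2) ℂ) :=
  {P | ∃ k : Fin 4, ∃ x : Fin n → Fin 4, P = Complex.I ^ (k : ℕ) • pauli x}

def phs : Fin 4 → Fin 4 → ℂ := fun a b =>
  if a = 0 ∨ b = 0 ∨ a = b then 1 else
  if (a = 1 ∧ b = 2) ∨ (a = 2 ∧ b = 3) ∨ (a = 3 ∧ b = 1) then Complex.I else -Complex.I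

def mxor : Fin 4 → Fin 4 → Fin 4 := fun a b => a ^^^ b

lemma sigma_mul (a b : Fin 4) : sigma a * sigma b = phs a b • sigma (mxor a b) := by
  fin_cases a <;> fin_cases b <;> ext i j <;> fin_cases i <;> fin_cases j <;>
    simp [sigma, phs, mxor, Matrix.mul_apply, Fin.sum_univ_two]

lemma phs_four (a b : Fin 4) : phs a b ^ 4 = 1 := by
  unfold phs; split_ifs
  · simp
  · exact Complex.I_pow_four
  · rw [Even.neg_pow (by decide), Complex.I_pow_four]

lemma sigma_star (a : Fin 4) (i j : Fin 2) : star (sigma a j i) = sigma a i j := by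
  fin_cases a <;> fin_cases i <;> fin_cases j <;> simp [sigma]

lemma sigma_twirl (i j k l : Fin 2) :
    ∑ a, sigma a i j * sigma a k l = if i = l ∧ j = k then 2 else 0 := by
  fin_cases i <;> fin_cases j <;> fin_cases k <;> fin_cases l <;>
    simp [sigma, Fin.sum_univ_four] <;> norm_num

lemma sigma_trace (a : Fin 4) : ∑ i, sigma a i i = if a = 0 then 2 else 0 := by
  fin_cases a <;> simp [sigma, Fin.sum_univ_two]

lemma mxor_self (a : Fin 4) : mxor a a = 0 := by revert a; decide
lemma mxor_zero_iff (a b : Fin 4) : mxor a b = 0 ↔ a = b := by revert a b; decide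
lemma mxor_inv (a b : Fin 4) : mxor a (mxor a b) = b := by revert a b; decide

variable {n : ℕ}

def pxor (x y : Fin n → Fin 4) : Fin n → Fin 4 := fun k => mxor (x k) (y k)
noncomputable def pph (x y : Fin n → Fin 4) : ℂ := ∏ k, phs (x k) (y k)

lemma pph_four (x y : Fin n → Fin 4) : pph x y ^ 4 = 1 := by
  unfold pph; rw [← Finset.prod_pow]; simp [phs_four]

lemma pauli_mul (x y : Fin n → Fin 4) :
    pauli x * pauli y = pph x y • pauli (pxor x y) := by
  ext i j
  simp only [Matrix.mul_apply, pauli, Matrix.smul_apply, smul_eq_mul, pph, pxor]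
  rw [← Finset.prod_mul_distrib]
  simp_rw [← Finset.prod_mul_distrib]
  have := Finset.prod_univ_sum (fun _ : Fin n => (Finset.univ : Finset (Fin 2)))
    (fun k a => sigma (x k) (i k) a * sigma (y k) a (j k))
  rw [Fintype.piFinset_univ] at this
  rw [← this]
  refine Finset.prod_congr rfl fun k _ => ?_
  have h := congrFun (congrFun (sigma_mul (x k) (y k)) (i k)) (j k)
  simpa [Matrix.mul_apply] using h

lemma pauli_zero : pauli (0 : Fin n → Fin 4) = 1 := by
  ext i j
  simp only [pauli, Pi.zero_apply, sigma, Matrix.one_apply]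
  by_cases h : i = j
  · simp [h]
  · rw [if_neg h]
    obtain ⟨k, hk⟩ := Function.ne_iff.mp h
    exact Finset.prod_eq_zero (Finset.mem_univ k) (by simp [hk])

lemma pauli_sq (x : Fin n → Fin 4) : pauli x * pauli x = 1 := by
  rw [pauli_mul]
  have h1 : pph x x = 1 := by simp [pph, phs]
  have h2 : pxor x x = 0 := by ext k; simp [pxor, mxor_self]
  rw [h1, h2, pauli_zero, one_smul]

lemma pauli_herm (x : Fin n → Fin 4) : (pauli x)ᴴ = pauli x := by
  ext i j
  simp only [Matrix.conjTranspose_apply, pauli, star_prod, sigma_star]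

lemma pauli_trace (x : Fin n → Fin 4) :
    (pauli x).trace = if x = 0 then 2 ^ n else 0 := by
  simp only [Matrix.trace, Matrix.diag, pauli]
  have := Finset.prod_univ_sum (fun _ : Fin n => (Finset.univ : Finset (Fin 2)))
    (fun k a => sigma (x k) a a)
  rw [Fintype.piFinset_univ] at this
  rw [← this]
  simp_rw [sigma_trace]
  split_ifs with h
  · simp [h]
  · obtain ⟨k, hk⟩ := Function.ne_iff.mp h
    exact Finset.prod_eq_zero (Finset.mem_univ k) (by simpa using hk)

lemma pauli_trace_mul (x y : Fin n → Fin 4) :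
    (pauli x * pauli y).trace = if x = y then 2 ^ n else 0 := by
  by_cases h : x = y
  · subst h; rw [pauli_sq]; simp
  · rw [pauli_mul, Matrix.trace_smul, pauli_trace, if_neg h, if_neg, smul_zero]
    intro h'
    exact h (funext fun k => (mxor_zero_iff _ _).1 (congrFun h' k))

lemma pauli_twirl (A : Matrix (Fin n → Fin 2) (Fin n → Fin 2) ℂ) :
    ∑ x, pauli x * A * pauli x = (2 ^ n * A.trace) • 1 := by
  have key : ∀ i j k l : Fin n → Fin 2,
      ∑ x, pauli x i j * pauli x k l = if i = l ∧ j = k then (2:ℂ) ^ n else 0 := by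
    intro i j k l
    simp only [pauli, ← Finset.prod_mul_distrib]
    have := Finset.prod_univ_sum (fun _ : Fin n => (Finset.univ : Finset (Fin 4)))
      (fun t a => sigma a (i t) (j t) * sigma a (k t) (l t))
    rw [Fintype.piFinset_univ] at this
    rw [← this]
    simp_rw [sigma_twirl]
    split_ifs with h
    · simp [h.1, h.2]
    · rw [not_and_or] at h
      rcases h with h | h <;> obtain ⟨t, ht⟩ := Function.ne_iff.mp h <;>
        exact Finset.prod_eq_zero (Finset.mem_univ t) (by simp [ht])
  ext i l
  rw [Matrix.sum_apply]
  simp only [Matrix.mul_apply, Finset.sum_mul]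
  rw [Finset.sum_comm]
  have : ∀ k, ∑ x : Fin n → Fin 4, ∑ j, pauli x i j * A j k * pauli x k l
      = ∑ j, A j k * (if i = l ∧ j = k then (2:ℂ) ^ n else 0) := by
    intro k
    rw [Finset.sum_comm]
    refine Finset.sum_congr rfl fun j _ => ?_
    rw [← key, Finset.mul_sum]
    refine Finset.sum_congr rfl fun x _ => ?_
    ring
  simp_rw [this]
  by_cases h : i = l
  · subst h
    simp [Matrix.trace, ← Finset.sum_mul, mul_comm]
  · simp [h, Matrix.one_apply]

lemma scalar_of_commute (A : Matrix (Fin n → Fin 2) (Fin n → Fin 2) ℂ)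
    (h : ∀ x, pauli x * A = A * pauli x) : A = (A.trace / 2 ^ n) • 1 := by
  have h1 := pauli_twirl A
  simp_rw [h, Matrix.mul_assoc, pauli_sq, Matrix.mul_one] at h1
  rw [Finset.sum_const, Finset.card_univ, Fintype.card_fun] at h1
  simp only [Fintype.card_fin] at h1
  have h2 : ((2:ℂ)^n) ≠ 0 := pow_ne_zero _ two_ne_zero
  have h4 : ((4 ^ n : ℕ) : ℂ) = 2 ^ n * 2 ^ n := by
    push_cast; rw [← mul_pow]; norm_num
  rw [← Nat.cast_smul_eq_nsmul ℂ, h4] at h1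
  have h3 := congrArg (fun M => ((2:ℂ)^n * 2^n)⁻¹ • M) h1
  simp only [smul_smul] at h3
  rw [inv_mul_cancel₀ (mul_ne_zero h2 h2), one_smul] at h3
  rw [h3, ← div_eq_inv_mul, mul_div_mul_left _ _ h2]
  simp

section norm
variable {ι : Type*} [Fintype ι] [DecidableEq ι]

attribute [local instance] Matrix.frobeniusNormedAddCommGroup Matrix.frobeniusNormedSpace

lemma frob_sq (A : Matrix ι ι ℂ) : ‖A‖ ^ 2 = (Matrix.trace (Aᴴ * A)).re := by
  rw [Matrix.frobenius_norm_def, ← Real.sqrt_eq_rpow, Real.sq_sqrt (by positivity)]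
  simp only [Matrix.trace, Matrix.diag, Matrix.mul_apply, Matrix.conjTranspose_apply,
    Complex.re_sum]
  rw [Finset.sum_comm]
  refine Finset.sum_congr rfl fun i _ => Finset.sum_congr rfl fun j _ => ?_
  rw [Real.rpow_two, ← Complex.normSq_eq_norm_sq, Complex.normSq_apply]
  simp

lemma fnorm_eq (A : Matrix ι ι ℂ) : fnorm A = ‖A‖ := by
  rw [fnorm, ← frob_sq, Real.sqrt_sq (norm_nonneg _)]

lemma frob_mul_left (V A : Matrix ι ι ℂ) (hV : Vᴴ * V = 1) : ‖V * A‖ = ‖A‖ := by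
  rw [← sq_eq_sq₀ (norm_nonneg _) (norm_nonneg _), frob_sq, frob_sq,
    Matrix.conjTranspose_mul, Matrix.mul_assoc, ← Matrix.mul_assoc Vᴴ, hV, Matrix.one_mul]

lemma frob_mul_right (V A : Matrix ι ι ℂ) (hV : V * Vᴴ = 1) : ‖A * V‖ = ‖A‖ := by
  rw [← sq_eq_sq₀ (norm_nonneg _) (norm_nonneg _), frob_sq, frob_sq,
    Matrix.conjTranspose_mul, Matrix.mul_assoc, Matrix.trace_mul_comm, Matrix.mul_assoc,
    Matrix.mul_assoc, hV, Matrix.mul_one]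

lemma frob_sub_sq (A B : Matrix ι ι ℂ) (hA : Aᴴ * A = 1) (hB : Bᴴ * B = 1) :
    ‖A - B‖ ^ 2 = 2 * Fintype.card ι - 2 * (Matrix.trace (Aᴴ * B)).re := by
  have h : (Matrix.trace (Bᴴ * A)).re = (Matrix.trace (Aᴴ * B)).re := by
    rw [← Complex.conj_re, ← Complex.star_def, ← Matrix.trace_conjTranspose]
    simp [Matrix.conjTranspose_mul]
  rw [frob_sq, Matrix.conjTranspose_sub, Matrix.sub_mul, Matrix.mul_sub, Matrix.mul_sub, hA, hB]
  simp only [Matrix.trace_sub, Complex.sub_re, h, Matrix.trace_one, Complex.natCast_re]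
  ring

lemma exp_unit (θ : ℝ) (A : Matrix ι ι ℂ) (hA : Aᴴ * A = 1) :
    (Complex.exp (θ * Complex.I) • A)ᴴ * (Complex.exp (θ * Complex.I) • A) = 1 := by
  rw [Matrix.conjTranspose_smul, Matrix.smul_mul, Matrix.mul_smul, smul_smul, hA, Complex.star_def,
    ← Complex.normSq_eq_conj_mul_self, Complex.normSq_eq_norm_sq, Complex.norm_exp_ofReal_mul_I]
  simp

lemma uDist_lower [Nonempty ι] (A B : Matrix ι ι ℂ) (hA : Aᴴ * A = 1) (hB : Bᴴ * B = 1)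
    {δ : ℝ} (h : uDist A B ≤ δ) (hδ : 0 ≤ δ) :
    Fintype.card ι * (1 - δ ^ 2) ≤ ‖Matrix.trace (Aᴴ * B)‖ := by
  set c : ℝ := (Fintype.card ι : ℝ) with hc
  have hc0 : 0 < c := by rw [hc]; exact_mod_cast Fintype.card_pos
  by_contra hlt
  push Not at hlt
  have hlow : Real.sqrt (1 - ‖Matrix.trace (Aᴴ * B)‖ / c) ≤ uDist A B := by
    refine le_csInf ⟨_, ⟨0, ⟨le_rfl, by positivity⟩, rfl⟩⟩ ?_
    rintro _ ⟨θ, -, rfl⟩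
    simp only
    rw [fnorm_eq, ← div_eq_inv_mul]
    apply Real.sqrt_le_iff.2
    refine ⟨by positivity, ?_⟩
    rw [div_pow, Real.sq_sqrt (by positivity), frob_sub_sq _ _ (exp_unit θ A hA) hB,
      Matrix.conjTranspose_smul, Matrix.smul_mul, Matrix.trace_smul]
    have h1 : (star (Complex.exp (θ * Complex.I)) • (Aᴴ * B).trace).re ≤ ‖(Aᴴ * B).trace‖ := by
      refine (Complex.re_le_norm _).trans ?_
      rw [smul_eq_mul, norm_mul, norm_star, Complex.norm_exp_ofReal_mul_I, one_mul]
    rw [← hc, le_div_iff₀ (by positivity)]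
    have : (1 - ‖(Aᴴ * B).trace‖ / c) * (2 * c) = 2 * c - 2 * ‖(Aᴴ * B).trace‖ := by
      field_simp
    rw [this]; linarith
  have h2 := hlow.trans h
  rw [Real.sqrt_le_left hδ] at h2
  have h3 : ‖(Aᴴ * B).trace‖ / c < 1 - δ^2 := by
    rw [div_lt_iff₀ hc0]; linarith
  linarith

lemma uDist_upper [Nonempty ι] (A B : Matrix ι ι ℂ) (hA : Aᴴ * A = 1) (hB : Bᴴ * B = 1)
    {δ : ℝ} (hδ : 0 ≤ δ) (h : Fintype.card ι * (1 - δ ^ 2) ≤ (Matrix.trace (Aᴴ * B)).re) :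
    uDist A B ≤ δ := by
  have hc0 : (0:ℝ) < Fintype.card ι := by exact_mod_cast Fintype.card_pos
  unfold uDist
  refine (csInf_le ⟨0, ?_⟩ (Set.mem_image_of_mem _
    (Set.mem_Ico.2 ⟨le_refl (0:ℝ), by positivity⟩))).trans ?_
  · rintro _ ⟨θ, -, rfl⟩
    simp only [fnorm_eq]
    positivity
  · simp only [fnorm_eq, Complex.ofReal_zero, zero_mul, Complex.exp_zero, one_smul]
    rw [← div_eq_inv_mul]
    rw [← sq_le_sq₀ (by positivity) hδ]
    rw [div_pow, Real.sq_sqrt (by positivity), frob_sub_sq _ _ hA hB, div_le_iff₀ (by positivity)]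
    linarith

end norm

lemma four_root {ω : ℂ} (h : ω ^ 4 = 1) :
    ω = 1 ∨ ω = -1 ∨ ω = Complex.I ∨ ω = -Complex.I := by
  have : (ω - 1) * ((ω + 1) * ((ω - Complex.I) * (ω + Complex.I))) = 0 := by
    linear_combination h - (ω ^ 2 - 1) * Complex.I_sq
  rcases mul_eq_zero.1 this with h | h
  · left; linear_combination h
  rcases mul_eq_zero.1 h with h | h
  · right; left; linear_combination h
  rcases mul_eq_zero.1 h with h | h
  · right; right; left; linear_combination h
  · right; right; right; linear_combination h

lemma four_root_pow {ω : ℂ} (h : ω ^ 4 = 1) : ∃ k : Fin 4, ω = Complex.I ^ (k : ℕ) := by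
  rcases four_root h with h | h | h | h
  · exact ⟨0, by simp [h]⟩
  · exact ⟨2, by simp [h]⟩
  · exact ⟨1, by simp [h]⟩
  · exact ⟨3, by simp [h]⟩

lemma star_four {ω : ℂ} (h : ω ^ 4 = 1) : star ω * ω = 1 := by
  rcases four_root h with h | h | h | h <;> simp [h]

lemma mem_pauliGroup {ω : ℂ} (h : ω ^ 4 = 1) (x : Fin n → Fin 4) :
    ω • pauli x ∈ PauliGroup n := by
  obtain ⟨k, rfl⟩ := four_root_pow h
  exact ⟨k, x, rfl⟩

lemma pauliGroup_finite : (PauliGroup n).Finite := by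
  refine (Set.finite_range (fun p : Fin 4 × (Fin n → Fin 4) =>
    Complex.I ^ (p.1 : ℕ) • pauli p.2)).subset ?_
  rintro P ⟨k, x, rfl⟩
  exact ⟨(k, x), rfl⟩

lemma ph_unit {ω : ℂ} (h : ω ^ 4 = 1) (x : Fin n → Fin 4) :
    (ω • pauli x)ᴴ * (ω • pauli x) = 1 := by
  rw [Matrix.conjTranspose_smul, pauli_herm, Matrix.smul_mul, Matrix.mul_smul, smul_smul,
    star_four h, pauli_sq, one_smul]

attribute [local instance] Matrix.frobeniusNormedAddCommGroup Matrix.frobeniusNormedSpace in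
lemma sep {ω ω' : ℂ} (h : ω ^ 4 = 1) (h' : ω' ^ 4 = 1) (x y : Fin n → Fin 4)
    (hd : ‖ω • pauli x - ω' • pauli y‖ ^ 2 < 2 * 2 ^ n) : ω • pauli x = ω' • pauli y := by
  rw [frob_sub_sq _ _ (ph_unit h x) (ph_unit h' y), Matrix.conjTranspose_smul, pauli_herm,
    Matrix.smul_mul, Matrix.mul_smul, smul_smul, Matrix.trace_smul, pauli_trace_mul] at hd
  have hcard : (Fintype.card (Fin n → Fin 2) : ℝ) = 2 ^ n := by simp
  rw [hcard] at hd
  split_ifs at hd with hxy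
  · subst hxy
    have e : ((star ω * ω') • (2:ℂ) ^ n).re = (star ω * ω').re * 2 ^ n := by
      rw [smul_eq_mul, show ((2:ℂ)^n) = ((2 ^ n : ℝ) : ℂ) by push_cast; rfl, Complex.re_mul_ofReal]
    rw [e] at hd
    have hp : (0:ℝ) < 2 ^ n := by positivity
    have h0 : 0 < (star ω * ω').re := by
      by_contra hn
      push Not at hn
      nlinarith
    rcases four_root h with h | h | h | h <;> rcases four_root h' with h' | h' | h' | h' <;>
      subst h <;> subst h' <;> first | rfl | (exfalso; norm_num at h0)
  · simp at hd

lemma get_h {δ : ℝ} (hδ : 0 ≤ δ)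
    (U : Matrix (Fin n → Fin 2) (Fin n → Fin 2) ℂ) (h1 : U * Uᴴ = 1) (h2 : Uᴴ * U = 1)
    (x : Fin n → Fin 4) (hx : uDistSet (U * pauli x * Uᴴ) (PauliGroup n) ≤ δ) :
    ∃ (s : ℂ) (f : Fin n → Fin 4), (s = 1 ∨ s = -1) ∧
      2 ^ n * (1 - δ ^ 2) ≤ (Matrix.trace ((U * pauli x * Uᴴ) * (s • pauli f))).re := by
  set A := U * pauli x * Uᴴ with hA
  have hAh : Aᴴ = A := by
    simp [hA, Matrix.conjTranspose_mul, pauli_herm, Matrix.mul_assoc]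
  have hAA : A * A = 1 := by
    calc A * A = U * (pauli x * (Uᴴ * U) * pauli x) * Uᴴ := by
          simp only [hA, Matrix.mul_assoc]
      _ = 1 := by rw [h2, Matrix.mul_one, pauli_sq, Matrix.mul_one, h1]
  have hfin : (uDist A '' PauliGroup n).Finite := pauliGroup_finite.image _
  have hne : (uDist A '' PauliGroup n).Nonempty :=
    ⟨_, _, mem_pauliGroup (one_pow 4) 0, rfl⟩
  obtain ⟨P, ⟨k, f, rfl⟩, hP⟩ := hne.csInf_mem hfin
  have hk : (Complex.I ^ (k : ℕ)) ^ 4 = 1 := by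
    rw [← pow_mul, mul_comm, pow_mul, Complex.I_pow_four, one_pow]
  have hd : uDist A (Complex.I ^ (k : ℕ) • pauli f) ≤ δ := by rw [hP]; exact hx
  have hl := uDist_lower _ _ (by rw [hAh, hAA]) (ph_unit hk f) hd hδ
  have hcard : (Fintype.card (Fin n → Fin 2) : ℝ) = 2 ^ n := by simp
  rw [hcard, Matrix.mul_smul, Matrix.trace_smul, norm_smul, norm_pow, Complex.norm_I, one_pow,
    one_mul, hAh] at hl
  have him : star (A * pauli f).trace = (A * pauli f).trace := by
    rw [← Matrix.trace_conjTranspose, Matrix.conjTranspose_mul, hAh, pauli_herm,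
      Matrix.trace_mul_comm]
  obtain ⟨r, hr⟩ := Complex.conj_eq_iff_real.1 him
  rw [hr, Complex.norm_real, Real.norm_eq_abs] at hl
  rcases le_total 0 r with h0 | h0
  · refine ⟨1, f, Or.inl rfl, ?_⟩
    rw [one_smul, hr, Complex.ofReal_re]
    rwa [abs_of_nonneg h0] at hl
  · refine ⟨-1, f, Or.inr rfl, ?_⟩
    rw [neg_one_smul, Matrix.mul_neg, Matrix.trace_neg, hr, Complex.neg_re, Complex.ofReal_re]
    rwa [abs_of_nonpos h0] at hl

attribute [local instance] Matrix.frobeniusNormedAddCommGroup Matrix.frobeniusNormedSpace in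
lemma h_mul {δ : ℝ} (hδ : 0 ≤ δ) (hδ4 : δ < 1 / 4)
    (U : Matrix (Fin n → Fin 2) (Fin n → Fin 2) ℂ) (h1 : U * Uᴴ = 1) (h2 : Uᴴ * U = 1)
    (s : (Fin n → Fin 4) → ℂ) (f : (Fin n → Fin 4) → (Fin n → Fin 4))
    (hs : ∀ x, s x = 1 ∨ s x = -1)
    (hh : ∀ x, 2 ^ n * (1 - δ ^ 2) ≤
      (Matrix.trace ((U * pauli x * Uᴴ) * (s x • pauli (f x)))).re) (x y : Fin n → Fin 4) :
    (s x • pauli (f x)) * (s y • pauli (f y)) =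
      pph x y • (s (pxor x y) • pauli (f (pxor x y))) := by
  have hs4 : ∀ x, s x ^ 4 = 1 := fun x => by rcases hs x with h | h <;> rw [h] <;> norm_num
  have hAh : ∀ x, (U * pauli x * Uᴴ)ᴴ = U * pauli x * Uᴴ := fun x => by
    simp [Matrix.conjTranspose_mul, pauli_herm, Matrix.mul_assoc]
  have hAm : ∀ x y, (U * pauli x * Uᴴ) * (U * pauli y * Uᴴ) = U * (pauli x * pauli y) * Uᴴ := by
    intro x y
    calc _ = U * (pauli x * (Uᴴ * U) * pauli y) * Uᴴ := by
          simp only [Matrix.mul_assoc]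
      _ = _ := by rw [h2, Matrix.mul_one]
  have hAA : ∀ x, (U * pauli x * Uᴴ)ᴴ * (U * pauli x * Uᴴ) = 1 := fun x => by
    rw [hAh, hAm, pauli_sq, Matrix.mul_one, h1]
  have hcard : (Fintype.card (Fin n → Fin 2) : ℝ) = 2 ^ n := by simp
  set r : ℝ := Real.sqrt (2 * 2 ^ n * δ ^ 2) with hr
  have hr2 : r ^ 2 = 2 * 2 ^ n * δ ^ 2 := Real.sq_sqrt (by positivity)
  have hd : ∀ x, ‖U * pauli x * Uᴴ - s x • pauli (f x)‖ ≤ r := by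
    intro x
    apply Real.le_sqrt_of_sq_le
    rw [frob_sub_sq _ _ (hAA x) (ph_unit (hs4 x) _), hcard, hAh]
    have := hh x
    linarith
  have hphn : ‖pph x y‖ = 1 := by
    have := congrArg norm (pph_four x y)
    rw [norm_pow, norm_one] at this
    exact (pow_eq_one_iff_of_nonneg (norm_nonneg _) (by norm_num)).1 this
  have hu : (s y • pauli (f y)) * (s y • pauli (f y))ᴴ = 1 :=
    mul_eq_one_comm.1 (ph_unit (hs4 y) (f y))
  have hprod : (s x • pauli (f x)) * (s y • pauli (f y)) =
      (s x * s y * pph (f x) (f y)) • pauli (pxor (f x) (f y)) := by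
    rw [Matrix.smul_mul, Matrix.mul_smul, pauli_mul, smul_smul, smul_smul, mul_assoc]
  have hdec : (s x • pauli (f x)) * (s y • pauli (f y)) -
        pph x y • (s (pxor x y) • pauli (f (pxor x y))) =
      - ((U * pauli x * Uᴴ - s x • pauli (f x)) * (s y • pauli (f y)))
      - (U * pauli x * Uᴴ) * (U * pauli y * Uᴴ - s y • pauli (f y))
      + pph x y • (U * pauli (pxor x y) * Uᴴ - s (pxor x y) • pauli (f (pxor x y))) := by
    rw [Matrix.sub_mul, Matrix.mul_sub, hAm, pauli_mul x y, smul_sub,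
      Matrix.mul_smul U, Matrix.smul_mul _ _ Uᴴ]
    abel
  have hnorm : ‖(s x • pauli (f x)) * (s y • pauli (f y)) -
        pph x y • (s (pxor x y) • pauli (f (pxor x y)))‖ ≤ 3 * r := by
    rw [hdec]
    refine (norm_add_le _ _).trans ?_
    refine (add_le_add (norm_sub_le _ _) le_rfl).trans ?_
    rw [norm_neg, frob_mul_right _ _ hu, frob_mul_left _ _ (hAA x), norm_smul, hphn, one_mul]
    linarith [hd x, hd y, hd (pxor x y)]
  rw [hprod, smul_smul] at hnorm ⊢
  apply sep
  · rw [mul_pow, mul_pow, hs4, hs4, pph_four]; norm_num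
  · rw [mul_pow, hs4, pph_four]; norm_num
  · have h9 := pow_le_pow_left₀ (norm_nonneg _) hnorm 2
    refine h9.trans_lt ?_
    rw [mul_pow, hr2]
    have hp : (0:ℝ) < 2 ^ n := by positivity
    have : δ ^ 2 < 1 / 16 := by nlinarith
    nlinarith

lemma pauliGroup_conj_neg (h : Matrix (Fin n → Fin 2) (Fin n → Fin 2) ℂ) (hh : h ∈ PauliGroup n) :
    (-1 : Matrix (Fin n → Fin 2) (Fin n → Fin 2) ℂ) * h * (-1)ᴴ ∈ PauliGroup n := by
  simpa using hh

attribute [local instance] Matrix.frobeniusNormedAddCommGroup Matrix.frobeniusNormedSpace in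
lemma main_lemma {δ : ℝ} (hδ : 0 ≤ δ) (hδ4 : δ < 1 / 4)
    (U : Matrix (Fin n → Fin 2) (Fin n → Fin 2) ℂ) (h1 : U * Uᴴ = 1) (h2 : Uᴴ * U = 1)
    (s : (Fin n → Fin 4) → ℂ) (f : (Fin n → Fin 4) → (Fin n → Fin 4))
    (hs : ∀ x, s x = 1 ∨ s x = -1)
    (hh : ∀ x, 2 ^ n * (1 - δ ^ 2) ≤
      (Matrix.trace ((U * pauli x * Uᴴ) * (s x • pauli (f x)))).re) :
    ∃ C : Matrix (Fin n → Fin 2) (Fin n → Fin 2) ℂ, Cᴴ * C = 1 ∧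
      (∀ x, C * pauli x * Cᴴ = s x • pauli (f x)) ∧ uDist U C ≤ δ := by
  have hs4 : ∀ x, s x ^ 4 = 1 := fun x => by rcases hs x with h | h <;> rw [h] <;> norm_num
  have hmul := h_mul hδ hδ4 U h1 h2 s f hs hh
  set h : (Fin n → Fin 4) → Matrix (Fin n → Fin 2) (Fin n → Fin 2) ℂ :=
    fun x => s x • pauli (f x) with hdef
  have hcard : (Fintype.card (Fin n → Fin 2) : ℝ) = 2 ^ n := by simp
  have hherm : ∀ x, (h x)ᴴ = h x := fun x => by
    simp only [hdef, Matrix.conjTranspose_smul, pauli_herm]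
    rcases hs x with e | e <;> rw [e] <;> simp
  have hunit : ∀ x, (h x)ᴴ * h x = 1 := fun x => ph_unit (hs4 x) _
  have hM : ∀ x y, h x * h y = pph x y • h (pxor x y) := hmul
  have hH : ∀ x, 2 ^ n * (1 - δ ^ 2) ≤ (Matrix.trace ((U * pauli x * Uᴴ) * h x)).re := hh
  -- the intertwiner
  set S : Matrix (Fin n → Fin 2) (Fin n → Fin 2) ℂ := ∑ x, h x * U * pauli x with hS
  have hinv : ∀ y : Fin n → Fin 4, Function.Involutive (pxor y) := fun y x => by
    funext k; simp [pxor, mxor_inv]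
  have hint : ∀ y, h y * S = S * pauli y := by
    intro y
    rw [hS, Finset.mul_sum, Finset.sum_mul]
    rw [← Equiv.sum_comp (hinv y).toPerm (fun x => h x * U * pauli x * pauli y)]
    refine Finset.sum_congr rfl fun x _ => ?_
    simp only [Function.Involutive.coe_toPerm]
    have e1 : pauli (pxor y x) * pauli y = pph y x • pauli x := by
      have e2 := congrArg Matrix.conjTranspose (pauli_mul y x)
      rw [Matrix.conjTranspose_mul, Matrix.conjTranspose_smul, pauli_herm, pauli_herm,
        pauli_herm] at e2
      have e3 : pauli (pxor y x) = pph y x • (pauli x * pauli y) := by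
        rw [e2, smul_smul, mul_comm, star_four (pph_four y x), one_smul]
      rw [e3, Matrix.smul_mul, Matrix.mul_assoc, pauli_sq, Matrix.mul_one]
    rw [Matrix.mul_assoc (h (pxor y x) * U), e1, Matrix.mul_smul, ← Matrix.mul_assoc,
      ← Matrix.mul_assoc, hM, Matrix.smul_mul, Matrix.smul_mul]
  have hintH : ∀ y, Sᴴ * h y = pauli y * Sᴴ := by
    intro y
    have := congrArg Matrix.conjTranspose (hint y)
    rwa [Matrix.conjTranspose_mul, Matrix.conjTranspose_mul, hherm, pauli_herm] at this
  have hscal := scalar_of_commute (Sᴴ * S) (fun y => by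
    rw [← Matrix.mul_assoc, ← hintH, Matrix.mul_assoc, hint, Matrix.mul_assoc])
  -- trace lower bound
  have htr : (4:ℝ) ^ n * (2 ^ n * (1 - δ ^ 2)) ≤ (Matrix.trace (Uᴴ * S)).re := by
    have e : (Matrix.trace (Uᴴ * S)).re
        = ∑ x, (Matrix.trace ((U * pauli x * Uᴴ) * h x)).re := by
      rw [hS, Finset.mul_sum, Matrix.trace_sum, Complex.re_sum]
      refine Finset.sum_congr rfl fun x _ => ?_
      congr 1
      rw [show U * pauli x * Uᴴ * h x = (U * pauli x) * (Uᴴ * h x) by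
          simp only [Matrix.mul_assoc],
        Matrix.trace_mul_comm (U * pauli x)]
      simp only [Matrix.mul_assoc]
    rw [e]
    have := Finset.sum_le_sum (s := Finset.univ) (fun x _ => hH x)
    simpa using this
  -- norm upper bound
  have hnorm : ‖S‖ ≤ 4 ^ n * Real.sqrt (2 ^ n) := by
    have e : ∀ x, ‖h x * U * pauli x‖ = Real.sqrt (2 ^ n) := by
      intro x
      rw [frob_mul_right _ _ (by rw [pauli_herm, pauli_sq]), frob_mul_left _ _ (hunit x)]
      rw [← Real.sqrt_sq (norm_nonneg U), frob_sq, h2, Matrix.trace_one, Complex.natCast_re, hcard]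
    refine (norm_sum_le _ _).trans ?_
    simp [e]
  have hp : (0:ℝ) < 2 ^ n := by positivity
  have hp4 : (0:ℝ) < 4 ^ n := by positivity
  have hd1 : 0 < 1 - δ ^ 2 := by nlinarith
  have hS0 : 0 < ‖S‖ := by
    rw [norm_pos_iff]
    intro h0
    rw [h0] at htr
    simp only [Matrix.mul_zero, Matrix.trace_zero, Complex.zero_re] at htr
    have : 0 < (4:ℝ) ^ n * (2 ^ n * (1 - δ ^ 2)) := by positivity
    linarith
  have htrS : (Sᴴ * S).trace = ((‖S‖ ^ 2 : ℝ) : ℂ) := by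
    have : star (Sᴴ * S).trace = (Sᴴ * S).trace := by
      rw [← Matrix.trace_conjTranspose]; simp [Matrix.conjTranspose_mul]
    obtain ⟨r, hr⟩ := Complex.conj_eq_iff_real.1 this
    rw [frob_sq, hr, Complex.ofReal_re]
  set t : ℝ := Real.sqrt (2 ^ n) / ‖S‖ with ht
  have ht0 : 0 < t := by positivity
  have ht2 : t * t * ‖S‖ ^ 2 / 2 ^ n = 1 := by
    rw [ht, ← sq, div_pow, Real.sq_sqrt hp.le]; field_simp
  have hC : ((t : ℂ) • S)ᴴ * ((t : ℂ) • S) = 1 := by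
    rw [Matrix.conjTranspose_smul, Matrix.smul_mul, Matrix.mul_smul, smul_smul, hscal, htrS,
      smul_smul, Complex.star_def, Complex.conj_ofReal]
    have : ((t:ℂ) * t * (((‖S‖ ^ 2 : ℝ) : ℂ) / 2 ^ n)) = ((t * t * ‖S‖ ^ 2 / 2 ^ n : ℝ) : ℂ) := by
      push_cast; ring
    rw [this, ht2, Complex.ofReal_one, one_smul]
  refine ⟨(t : ℂ) • S, hC, ?_, ?_⟩
  · intro x
    change _ = h x
    rw [Matrix.smul_mul, ← hint, ← Matrix.mul_smul, Matrix.mul_assoc, mul_eq_one_comm.1 hC,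
      Matrix.mul_one]
  · apply uDist_upper _ _ h2 hC hδ
    rw [hcard, Matrix.mul_smul, Matrix.trace_smul, smul_eq_mul, Complex.re_ofReal_mul]
    refine le_trans ?_ (mul_le_mul_of_nonneg_left htr ht0.le)
    have ht4 : 1 ≤ t * 4 ^ n := by
      rw [ht, div_mul_eq_mul_div, le_div_iff₀ hS0]; linarith
    have : 0 < 2 ^ n * (1 - δ ^ 2) := by positivity
    nlinarith

/-- If D(Uσ_xU†, P_n) ≤ δ for every x ∈ Z₄ⁿ, then U is 4δ-close to
some Clifford unitary C (i.e. a unitary with ChC† ∈ P_n for all h ∈ P_n). -/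
theorem close_to_clifford {n : ℕ} {δ : ℝ} (hδ : 0 ≤ δ)
    (U : Matrix (Fin n → Fin 2) (Fin n → Fin 2) ℂ)
    (hU : U ∈ Matrix.unitaryGroup (Fin n → Fin 2) ℂ)
    (hx : ∀ x : Fin n → Fin 4, uDistSet (U * pauli x * Uᴴ) (PauliGroup n) ≤ δ) :
    ∃ C ∈ Matrix.unitaryGroup (Fin n → Fin 2) ℂ,
      (∀ h ∈ PauliGroup n, C * h * Cᴴ ∈ PauliGroup n) ∧
      uDist U C ≤ 4 * δ := by
  have h1 : U * Uᴴ = 1 := Matrix.mem_unitaryGroup_iff.1 hU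
  have h2 : Uᴴ * U = 1 := Matrix.mem_unitaryGroup_iff'.1 hU
  rcases lt_or_ge δ (1 / 4) with hδ4 | hδ4
  · choose s f hs hh using fun x => get_h hδ U h1 h2 x (hx x)
    obtain ⟨C, hC, hCx, hd⟩ := main_lemma hδ hδ4 U h1 h2 s f hs hh
    refine ⟨C, Matrix.mem_unitaryGroup_iff'.2 hC, ?_, by linarith⟩
    rintro _ ⟨k, x, rfl⟩
    rw [Matrix.mul_smul, Matrix.smul_mul, hCx, smul_smul]
    apply mem_pauliGroup
    rw [mul_pow, ← pow_mul, mul_comm (k : ℕ), pow_mul, Complex.I_pow_four, one_pow]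
    rcases hs x with h | h <;> rw [h] <;> norm_num
  · have hb : 1 - (4 * δ) ^ 2 ≤ 0 := by nlinarith
    have hb2 : (Fintype.card (Fin n → Fin 2) : ℝ) * (1 - (4 * δ) ^ 2) ≤ 0 :=
      mul_nonpos_of_nonneg_of_nonpos (by positivity) hb
    rcases le_total 0 (Matrix.trace Uᴴ).re with h0 | h0
    · refine ⟨1, one_mem _, fun h hh => by simpa using hh, ?_⟩
      apply uDist_upper _ _ h2 (by simp) (by linarith)
      rw [Matrix.mul_one]; linarith
    · refine ⟨-1, Matrix.mem_unitaryGroup_iff.2 (by simp), pauliGroup_conj_neg, ?_⟩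
      apply uDist_upper _ _ h2 (by simp) (by linarith)
      rw [Matrix.mul_neg, Matrix.mul_one, Matrix.trace_neg, Complex.neg_re]; linarith
end
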